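/- Let R be an indecomposable commutative ring, Y a Stone space, f : Y → Σ(R) continuous with respect to the Zariski topology, and suppose that f(y) is a local ring for every y ∈ Y. Let A = {a ∈ LocallyConstant(Y, R) : a(y) ∈ f(y) for all y ∈ Y} be the patch algebra of the patch bundle f. Then (1) A is a clean ring: every element of A is the sum of an idempotent element of A and a unit of A; and (2) for every maximal ideal M of A there exists y ∈ Y such that the localization of A at M is isomorphic, as a ring, to f(y). -/

import Mathlib

/-- The Zariski topology on the set of subrings of a commutative ring `R`,
generated by the sets `{S | r ∈ S}` for `r ∈ R`. -/
instance zariskiTopology (R : Type*) [CommRing R] : TopologicalSpace (Subring R) :=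
  TopologicalSpace.generateFrom {U : Set (Subring R) | ∃ r : R, U = {S : Subring R | r ∈ S}}

/-- The patch algebra of a family `f` of subrings of `R` indexed by a topological
space `Y`: the subring of `LocallyConstant Y R` consisting of the locally constant
functions `a` with `a y ∈ f y` for all `y`. -/
def patchAlgebra (Y : Type*) [TopologicalSpace Y] (R : Type*) [CommRing R]
    (f : Y → Subring R) : Subring (LocallyConstant Y R) where
  carrier := {a : LocallyConstant Y R | ∀ y : Y, a y ∈ f y}
  zero_mem' := fun y => by simpa using zero_mem (f y)
  one_mem' := fun y => by simpa using one_mem (f y)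
  add_mem' := fun {a b} ha hb y => by simpa using add_mem (ha y) (hb y)
  mul_mem' := fun {a b} ha hb y => by simpa using mul_mem (ha y) (hb y)
  neg_mem' := fun {a} ha y => by simpa using neg_mem (ha y)

section helpers
variable {R : Type*} [CommRing R] {Y : Type*} [TopologicalSpace Y] {f : Y → Subring R}

theorem patch_open (hf : Continuous f) (r : R) : IsOpen {z : Y | r ∈ f z} :=
  (TopologicalSpace.isOpen_generateFrom_of_mem ⟨r, rfl⟩ :
    IsOpen {S : Subring R | r ∈ S}).preimage hf

theorem patch_cut {C : Set Y} (hC : IsClopen C) (a : LocallyConstant Y R)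
    (ha : ∀ z ∈ C, a z ∈ f z) :
    ∃ b : patchAlgebra Y R f, (∀ z ∈ C, b.1 z = a z) ∧ ∀ z, z ∉ C → b.1 z = 0 := by
  have h1 : ∀ z ∈ C, a.indicator hC z = a z := fun z hz => Set.indicator_of_mem hz _
  have h2 : ∀ z, z ∉ C → a.indicator hC z = 0 := fun z hz => Set.indicator_of_notMem hz _
  refine ⟨⟨a.indicator hC, fun z => ?_⟩, h1, h2⟩
  by_cases hz : z ∈ C
  · rw [h1 z hz]; exact ha z hz
  · rw [h2 z hz]; exact zero_mem _

theorem patch_unit_open (hf : Continuous f) (a : LocallyConstant Y R) :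
    IsOpen {z : Y | ∃ s ∈ f z, a z * s = 1} := by
  rw [isOpen_iff_mem_nhds]
  rintro y ⟨s, hs, h⟩
  filter_upwards [(patch_open hf s).mem_nhds hs,
    (a.isLocallyConstant.isOpen_fiber (a y)).mem_nhds rfl] with z hz hz'
  exact ⟨s, hz, by rw [show a z = a y from hz', h]⟩

theorem patch_inverse {T : Subring R} {r : R} (h : ∃ s ∈ T, r * s = 1) :
    Ring.inverse r ∈ T ∧ r * Ring.inverse r = 1 := by
  obtain ⟨s, hs, h⟩ := h
  have hu : IsUnit r := IsUnit.of_mul_eq_one s h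
  have h3 := Ring.mul_inverse_cancel r hu
  have : Ring.inverse r = s := by
    calc Ring.inverse r = Ring.inverse r * (r * s) := by rw [h, mul_one]
      _ = (r * Ring.inverse r) * s := by ring
      _ = s := by rw [h3, one_mul]
  exact ⟨this ▸ hs, h3⟩

theorem patch_isUnit_iff {T : Subring R} (r : T) : IsUnit r ↔ ∃ s ∈ T, r.1 * s = 1 := by
  rw [isUnit_iff_exists_inv]
  constructor
  · rintro ⟨b, hb⟩
    exact ⟨b.1, b.2, congrArg Subtype.val hb⟩
  · rintro ⟨s, hs, h⟩
    exact ⟨⟨s, hs⟩, Subtype.ext h⟩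

theorem patch_ext {a b : patchAlgebra Y R f} (h : ∀ y, a.1 y = b.1 y) : a = b :=
  Subtype.ext (LocallyConstant.ext h)

/-- Evaluation at a point. -/
def patchEval (f : Y → Subring R) (y : Y) : patchAlgebra Y R f →+* f y where
  toFun a := ⟨a.1 y, a.2 y⟩
  map_one' := rfl
  map_zero' := rfl
  map_add' _ _ := rfl
  map_mul' _ _ := rfl

theorem patch_clean [CompactSpace Y] [T2Space Y] [TotallyDisconnectedSpace Y]
    (hf : Continuous f) (hloc : ∀ y : Y, IsLocalRing (f y)) (a : patchAlgebra Y R f) :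
    ∃ e u : patchAlgebra Y R f, IsIdempotentElem e ∧ IsUnit u ∧ a = e + u := by
  have hU := patch_unit_open hf a.1
  have hV := patch_unit_open hf (a - 1).1
  have hUV : {z : Y | ∃ s ∈ f z, a.1 z * s = 1}ᶜ ⊆ {z : Y | ∃ s ∈ f z, (a - 1).1 z * s = 1} := by
    intro z hz
    have := hloc z
    rcases IsLocalRing.isUnit_or_isUnit_one_sub_self (patchEval f z a) with h | h
    · exact absurd ((patch_isUnit_iff _).1 h) hz
    · have h' : IsUnit (patchEval f z (a - 1)) := by
        rw [map_sub, map_one, ← neg_sub]; exact h.neg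
      exact (patch_isUnit_iff _).1 h'
  obtain ⟨C, hC, hUC, hCV⟩ := exists_clopen_of_closed_subset_open hU.isClosed_compl hV hUV
  obtain ⟨e, he1, he0⟩ := patch_cut (f := f) hC 1 (fun z _ => one_mem (f z))
  have hu : ∀ z, ∃ s ∈ f z, (a - e).1 z * s = 1 := by
    intro z
    have hz' : (a - e).1 z = a.1 z - e.1 z := rfl
    by_cases hz : z ∈ C
    · rw [hz', he1 z hz]; exact hCV hz
    · rw [hz', he0 z hz, sub_zero]
      by_contra h
      exact hz (hUC h)
  refine ⟨e, a - e, ?_, ?_, by ring⟩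
  · refine patch_ext fun y => ?_
    change e.1 y * e.1 y = e.1 y
    by_cases hy : y ∈ C
    · rw [he1 y hy]; exact one_mul _
    · rw [he0 y hy, mul_zero]
  · rw [isUnit_iff_exists_inv]
    exact ⟨⟨(a - e).1.map Ring.inverse, fun y => (patch_inverse (hu y)).1⟩,
      patch_ext fun y => (patch_inverse (hu y)).2⟩

theorem patch_point [CompactSpace Y] [T2Space Y] [TotallyDisconnectedSpace Y]
    (hf : Continuous f) (M : Ideal (patchAlgebra Y R f)) (hM : M ≠ ⊤) :
    ∃ y, ∀ a ∈ M, ¬ IsUnit (patchEval f y a) := by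
  by_contra! hcon
  have key : ∃ e ∈ M, ∀ y ∈ (Set.univ : Set Y), e.1 y = 1 := by
    refine isCompact_univ.induction_on (p := fun s => ∃ e ∈ M, ∀ y ∈ s, e.1 y = 1) ?_ ?_ ?_ ?_
    · exact ⟨0, M.zero_mem, by simp⟩
    · rintro s t hst ⟨e, he, h⟩
      exact ⟨e, he, fun y hy => h y (hst hy)⟩
    · rintro s t ⟨e, he, h⟩ ⟨e', he', h'⟩
      refine ⟨e + e' - e * e', M.sub_mem (M.add_mem he he') (M.mul_mem_right _ he), ?_⟩
      intro y hy
      change e.1 y + e'.1 y - e.1 y * e'.1 y = 1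
      rcases hy with hy | hy
      · rw [h y hy]; ring
      · rw [h' y hy]; ring
    · intro y _
      obtain ⟨a, ha, hu⟩ := hcon y
      obtain ⟨C, hC, hyC, hCU⟩ := compact_exists_isClopen_in_isOpen
        (patch_unit_open hf a.1) ((patch_isUnit_iff _).1 hu)
      obtain ⟨b, hb, _⟩ := patch_cut (f := f) hC (a.1.map Ring.inverse)
        (fun z hz => (patch_inverse (hCU hz)).1)
      refine ⟨C, mem_nhdsWithin_of_mem_nhds (hC.isOpen.mem_nhds hyC), a * b,
        M.mul_mem_right _ ha, fun z hz => ?_⟩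
      change a.1 z * b.1 z = 1
      rw [hb z hz]
      exact (patch_inverse (hCU hz)).2
  obtain ⟨e, he, h⟩ := key
  have : e = 1 := patch_ext fun y => h y trivial
  exact hM ((Ideal.eq_top_iff_one _).2 (this ▸ he))

theorem patch_localization [CompactSpace Y] [T2Space Y] [TotallyDisconnectedSpace Y]
    (hf : Continuous f) (hloc : ∀ y : Y, IsLocalRing (f y))
    (M : Ideal (patchAlgebra Y R f)) [hp : M.IsPrime] (hM : M.IsMaximal) :
    ∃ y : Y, Nonempty (Localization.AtPrime M ≃+* f y) := by
  obtain ⟨y, hy⟩ := patch_point hf M hM.ne_top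
  have := hloc y
  refine ⟨y, ?_⟩
  have hMe : M = (IsLocalRing.maximalIdeal (f y)).comap (patchEval f y) :=
    hM.eq_of_le (Ideal.IsPrime.ne_top inferInstance) fun a ha => hy a ha
  letI : Algebra (patchAlgebra Y R f) (f y) := (patchEval f y).toAlgebra
  have hnot : ∀ c : patchAlgebra Y R f, c ∉ M ↔ IsUnit (patchEval f y c) := by
    intro c
    rw [hMe, Ideal.mem_comap, IsLocalRing.mem_maximalIdeal, mem_nonunits_iff, not_not]
  have hL : IsLocalization M.primeCompl (f y) := by
    rw [isLocalization_iff]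
    refine ⟨fun c => (hnot _).1 c.2, fun z => ?_, fun {a b} hab => ?_⟩
    · obtain ⟨C, hC, hyC, hCU⟩ := compact_exists_isClopen_in_isOpen (patch_open hf z.1) z.2
      obtain ⟨b, hb, _⟩ := patch_cut (f := f) hC (LocallyConstant.const Y z.1)
        (fun w hw => hCU hw)
      refine ⟨(b, 1), ?_⟩
      simp only [OneMemClass.coe_one, map_one, mul_one]
      exact Subtype.ext (hb y hyC).symm
    · have hab' : (a - b).1 y = 0 := by
        change a.1 y - b.1 y = 0
        rw [sub_eq_zero]
        exact congrArg Subtype.val hab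
      obtain ⟨C, hC, hyC, hCU⟩ := compact_exists_isClopen_in_isOpen
        ((a - b).1.isLocallyConstant.isOpen_fiber 0) hab'
      obtain ⟨c, hc1, hc0⟩ := patch_cut (f := f) hC 1 (fun z _ => one_mem (f z))
      have hc : patchEval f y c = 1 := Subtype.ext (hc1 y hyC)
      refine ⟨⟨c, (hnot c).2 (hc ▸ isUnit_one)⟩, patch_ext fun z => ?_⟩
      change c.1 z * a.1 z = c.1 z * b.1 z
      by_cases hz : z ∈ C
      · have : a.1 z - b.1 z = 0 := hCU hz
        rw [sub_eq_zero.1 this]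
      · rw [hc0 z hz, zero_mul, zero_mul]
  exact ⟨(IsLocalization.algEquiv M.primeCompl (Localization.AtPrime M) (f y)).toRingEquiv⟩

end helpers

/-- Let `R` be an indecomposable commutative ring (its only idempotents are `0` and
`1`), `Y` a Stone space, `f : Y → Σ(R)` continuous for the Zariski topology with each
`f y` a local ring, and `A` the patch algebra of the patch bundle `f`.  Then (1) `A` is
clean: every element of `A` is the sum of an idempotent and a unit; and (2) for every
maximal ideal `M` of `A` there is `y ∈ Y` such that the localization of `A` at `M` is
isomorphic, as a ring, to `f y`. -/
theorem patchAlgebra_clean_and_localizations (R : Type*) [CommRing R]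
    (hR : ∀ e : R, IsIdempotentElem e → e = 0 ∨ e = 1)
    (Y : Type*) [TopologicalSpace Y] [CompactSpace Y] [T2Space Y]
    [TotallyDisconnectedSpace Y] (f : Y → Subring R) (hf : Continuous f)
    (hloc : ∀ y : Y, IsLocalRing (f y)) :
    (∀ a : patchAlgebra Y R f, ∃ e u : patchAlgebra Y R f,
        IsIdempotentElem e ∧ IsUnit u ∧ a = e + u) ∧
      ∀ M : Ideal (patchAlgebra Y R f), ∀ hM : M.IsMaximal,
        ∃ y : Y, Nonempty
          ((@Localization.AtPrime (patchAlgebra Y R f) _ M hM.isPrime) ≃+* f y) := by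
  exact ⟨patch_clean hf hloc, fun M hM => @patch_localization R _ Y _ f _ _ _ hf hloc M hM.isPrime hM⟩
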